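/- If C is a free E-linear code of length n, then (C^{⊥L})^{⊥L} = C and (C^{⊥R})^{⊥L} = C. -/

import Mathlib

open scoped BigOperators

/-- The non-unital ring `E` of order 4: the pair `(u, v)` represents `uκ + vζ`,
where `ζ = κ + τ`.  Multiplication: `(uκ + vζ)·(u'κ + v'ζ) = u'·(uκ + vζ)`. -/
def RingE : Type := ZMod 2 × ZMod 2

namespace RingE

instance : AddCommGroup RingE := inferInstanceAs (AddCommGroup (ZMod 2 × ZMod 2))

instance : Mul RingE := ⟨fun a b => Prod.mk (Prod.fst a * Prod.fst b) (Prod.snd a * Prod.fst b)⟩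

noncomputable instance : DecidableEq RingE := Classical.decEq _

instance : NonUnitalRing RingE where
  left_distrib a b c := by
    show Prod.mk (Prod.fst a * (Prod.fst b + Prod.fst c))
        (Prod.snd a * (Prod.fst b + Prod.fst c)) = _
    show _ = Prod.mk (Prod.fst a * Prod.fst b + Prod.fst a * Prod.fst c)
        (Prod.snd a * Prod.fst b + Prod.snd a * Prod.fst c)
    simp [mul_add]
  right_distrib a b c := by
    show Prod.mk ((Prod.fst a + Prod.fst b) * Prod.fst c)
        ((Prod.snd a + Prod.snd b) * Prod.fst c) = _
    show _ = Prod.mk (Prod.fst a * Prod.fst c + Prod.fst b * Prod.fst c)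
        (Prod.snd a * Prod.fst c + Prod.snd b * Prod.fst c)
    simp [add_mul]
  zero_mul a := by
    show Prod.mk ((0 : ZMod 2) * Prod.fst a) ((0 : ZMod 2) * Prod.fst a) = ((0 : ZMod 2), (0 : ZMod 2))
    simp
  mul_zero a := by
    show Prod.mk (Prod.fst a * (0 : ZMod 2)) (Prod.snd a * (0 : ZMod 2)) = ((0 : ZMod 2), (0 : ZMod 2))
    simp
  mul_assoc a b c := by
    show Prod.mk (Prod.fst a * Prod.fst b * Prod.fst c) (Prod.snd a * Prod.fst b * Prod.fst c)
      = Prod.mk (Prod.fst a * (Prod.fst b * Prod.fst c)) (Prod.snd a * (Prod.fst b * Prod.fst c))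
    simp [mul_assoc]

/-- The generator `κ`. -/
def kappa : RingE := Prod.mk 1 0

/-- The generator `τ`. -/
def tau : RingE := Prod.mk 1 1

/-- `ζ = κ + τ`. -/
def zeta : RingE := Prod.mk 0 1

/-- The reduction map `π : E → F₂`, sending `uκ + vζ` to `u`. -/
def pi (a : RingE) : ZMod 2 := Prod.fst a

/-- `κ·c` for a scalar `c ∈ F₂`, i.e. the element `cκ` of `E`. -/
def kappaSMul (c : ZMod 2) : RingE := Prod.mk c 0

/-- `ζ·c` for a scalar `c ∈ F₂`, i.e. the element `cζ` of `E`. -/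
def zetaSMul (c : ZMod 2) : RingE := Prod.mk 0 c

end RingE

namespace ECode

/-- Componentwise reduction `π : Eⁿ → F₂ⁿ`. -/
def piVec {n : ℕ} (x : Fin n → RingE) : Fin n → ZMod 2 := fun i => RingE.pi (x i)

/-- The vector `κv ∈ Eⁿ` attached to `v ∈ F₂ⁿ`. -/
def kappaVec {n : ℕ} (v : Fin n → ZMod 2) : Fin n → RingE := fun i => RingE.kappaSMul (v i)

/-- The vector `ζv ∈ Eⁿ` attached to `v ∈ F₂ⁿ`. -/
def zetaVec {n : ℕ} (v : Fin n → ZMod 2) : Fin n → RingE := fun i => RingE.zetaSMul (v i)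

/-- An `E`-linear code of length `n`: a left `E`-submodule of `Eⁿ`, i.e. an additive
subgroup closed under componentwise left multiplication by elements of `E`. -/
def IsECode {n : ℕ} (C : Set (Fin n → RingE)) : Prop :=
  (0 : Fin n → RingE) ∈ C ∧ (∀ x ∈ C, ∀ y ∈ C, x + y ∈ C) ∧ (∀ x ∈ C, -x ∈ C) ∧
    ∀ (a : RingE), ∀ x ∈ C, (fun i => a * x i) ∈ C

/-- The residue code `C_Res = π(C)`. -/
def Res {n : ℕ} (C : Set (Fin n → RingE)) : Set (Fin n → ZMod 2) := piVec '' C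

/-- The torsion code `C_Tor = {v ∈ F₂ⁿ : ζv ∈ C}`. -/
def Tor {n : ℕ} (C : Set (Fin n → RingE)) : Set (Fin n → ZMod 2) := {v | zetaVec v ∈ C}

/-- A code is free if its residue and torsion codes coincide. -/
def IsFree {n : ℕ} (C : Set (Fin n → RingE)) : Prop := Res C = Tor C

/-- The inner product on `Eⁿ`. -/
def Einner {n : ℕ} (w z : Fin n → RingE) : RingE := ∑ i, w i * z i

/-- The left dual `C^{⊥L}`. -/
def dualL {n : ℕ} (C : Set (Fin n → RingE)) : Set (Fin n → RingE) :=
  {z | ∀ w ∈ C, Einner z w = 0}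

/-- The right dual `C^{⊥R}`. -/
def dualR {n : ℕ} (C : Set (Fin n → RingE)) : Set (Fin n → RingE) :=
  {z | ∀ w ∈ C, Einner w z = 0}

/-- The (two-sided) dual `C^⊥ = C^{⊥L} ∩ C^{⊥R}`. -/
def dualE {n : ℕ} (C : Set (Fin n → RingE)) : Set (Fin n → RingE) := dualL C ∩ dualR C

/-- The left hull `LHull(C) = C ∩ C^{⊥L}`. -/
def LHull {n : ℕ} (C : Set (Fin n → RingE)) : Set (Fin n → RingE) := C ∩ dualL C

/-- The right hull `RHull(C) = C ∩ C^{⊥R}`. -/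
def RHull {n : ℕ} (C : Set (Fin n → RingE)) : Set (Fin n → RingE) := C ∩ dualR C

/-- The hull `Hull(C) = C ∩ C^⊥`. -/
def EHull {n : ℕ} (C : Set (Fin n → RingE)) : Set (Fin n → RingE) := C ∩ dualE C

/-- The Euclidean inner product on `F₂ⁿ`. -/
def Finner {n : ℕ} (w z : Fin n → ZMod 2) : ZMod 2 := ∑ i, w i * z i

/-- The Euclidean dual of an `F₂`-linear code. -/
def dualF {n : ℕ} (B : Set (Fin n → ZMod 2)) : Set (Fin n → ZMod 2) :=
  {z | ∀ w ∈ B, Finner w z = 0}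

/-- The hull of an `F₂`-linear code. -/
def FHull {n : ℕ} (B : Set (Fin n → ZMod 2)) : Set (Fin n → ZMod 2) := B ∩ dualF B

/-- `F₂`-dimension of an `F₂`-linear code (as the dimension of its span). -/
noncomputable def dimF {n : ℕ} (B : Set (Fin n → ZMod 2)) : ℕ :=
  Module.finrank (ZMod 2) (Submodule.span (ZMod 2) B)

/-- Scalar multiplication of a vector of `Eⁿ` by `a ∈ E`. -/
def smulVec {n : ℕ} (a : RingE) (x : Fin n → RingE) : Fin n → RingE := fun i => a * x i

/-- The left `E`-span `⟨X⟩_E` of a finite set `X ⊆ Eⁿ`. -/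
def spanE {n : ℕ} (X : Finset (Fin n → RingE)) : Set (Fin n → RingE) :=
  {y | ∃ c : (Fin n → RingE) → RingE, y = ∑ x ∈ X, smulVec (c x) x}

/-- The additive (`F₂`-) span `⟨X⟩_{F₂}` of a finite set `X ⊆ Eⁿ`: all sums of subsets. -/
def spanF {n : ℕ} (X : Finset (Fin n → RingE)) : Set (Fin n → RingE) :=
  {y | ∃ S : Finset (Fin n → RingE), S ⊆ X ∧ y = ∑ x ∈ S, x}

/-- `X` is a generating set of the code `D` if `⟨X⟩_E ∪ ⟨X⟩_{F₂} = D`. -/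
def IsGenSet {n : ℕ} (X : Finset (Fin n → RingE)) (D : Set (Fin n → RingE)) : Prop :=
  spanE X ∪ spanF X = D

/-- The rank of a (free) code: the minimum cardinality of a generating set. -/
noncomputable def genRank {n : ℕ} (D : Set (Fin n → RingE)) : ℕ :=
  sInf {m | ∃ X : Finset (Fin n → RingE), X.card = m ∧ IsGenSet X D}

/-- Prepending two coordinates to a vector of length `n`. -/
def cons2 {n : ℕ} (a b : RingE) (x : Fin n → RingE) : Fin (n + 2) → RingE :=
  Fin.cons a (Fin.cons b x)

end ECode


theorem Einner_eq_zero_iff {n : ℕ} (z w : Fin n → RingE) :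
    ECode.Einner z w = 0 ↔
      (∑ i, (z i).1 * (w i).1 = 0 ∧ ∑ i, (z i).2 * (w i).1 = 0) := by
  have h1 : (ECode.Einner z w).1 = ∑ i, (z i).1 * (w i).1 :=
    map_sum (AddMonoidHom.fst (ZMod 2) (ZMod 2)) (fun i => z i * w i) Finset.univ
  have h2 : (ECode.Einner z w).2 = ∑ i, (z i).2 * (w i).1 :=
    map_sum (AddMonoidHom.snd (ZMod 2) (ZMod 2)) (fun i => z i * w i) Finset.univ
  rw [← h1, ← h2]
  exact Prod.ext_iff

theorem exists_separating {n : ℕ} (x : Fin n → ZMod 2) (B : Submodule (ZMod 2) (Fin n → ZMod 2))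
    (h : ∀ z : Fin n → ZMod 2, (∀ w ∈ B, ∑ i, z i * w i = 0) → ∑ i, x i * z i = 0) :
    x ∈ B := by
  by_contra hx
  obtain ⟨f, hf, hB⟩ := Submodule.exists_le_ker_of_notMem hx
  have key : ∀ w : Fin n → ZMod 2, f w = ∑ i, w i * f (Pi.single i 1) := by
    intro w
    conv_lhs => rw [pi_eq_sum_univ' w]
    simp [map_sum]
  apply hf
  rw [key]
  apply h
  intro w hw
  have := hB hw
  rw [LinearMap.mem_ker, key] at this
  simpa [mul_comm] using this

open ECode in
theorem code_struct {n : ℕ} (C : Set (Fin n → RingE)) (hC : IsECode C) (hfree : IsFree C) :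
    ∃ B : Submodule (ZMod 2) (Fin n → ZMod 2), ∀ x : Fin n → RingE,
      x ∈ C ↔ (fun i => (x i).1) ∈ B ∧ (fun i => (x i).2) ∈ B := by
  obtain ⟨h0, hadd, hneg, hmul⟩ := hC
  have hiff : ∀ v, (∃ x ∈ C, piVec x = v) ↔ zetaVec v ∈ C := fun v => Set.ext_iff.mp hfree v
  have hz : ∀ v, zetaVec v ∈ C → kappaVec v ∈ C := by
    intro v hv
    obtain ⟨x, hx, rfl⟩ := (hiff v).2 hv
    convert hmul RingE.kappa x hx using 1
    funext i
    exact Prod.ext (one_mul _).symm (zero_mul _).symm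
  have hsplit : ∀ x : Fin n → RingE, x = kappaVec (fun i => (x i).1) + zetaVec (fun i => (x i).2) := by
    intro x
    funext i
    exact Prod.ext (add_zero _).symm (zero_add _).symm
  let G : AddSubgroup (Fin n → ZMod 2) :=
    { carrier := {v | zetaVec v ∈ C}
      zero_mem' := h0
      add_mem' := by
        intro a b ha hb
        change zetaVec (a + b) ∈ C
        convert hadd _ ha _ hb using 1
        funext i
        exact Prod.ext (add_zero _).symm rfl
      neg_mem' := by
        intro a ha
        change zetaVec (-a) ∈ C
        convert hneg _ ha using 1
        funext i
        exact Prod.ext neg_zero.symm rfl }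
  refine ⟨AddSubgroup.toZModSubmodule 2 G, fun x => ?_⟩
  change x ∈ C ↔ zetaVec (fun i => (x i).1) ∈ C ∧ zetaVec (fun i => (x i).2) ∈ C
  constructor
  · intro hx
    have h1 : zetaVec (fun i => (x i).1) ∈ C := (hiff _).1 ⟨x, hx, rfl⟩
    refine ⟨h1, ?_⟩
    have := hadd _ hx _ (hneg _ (hz _ h1))
    convert this using 1
    have hab : ∀ a b : Fin n → RingE, b = a + b + -a := fun a b => by abel
    exact (hab (kappaVec fun i => (x i).1) _).trans
      (congrArg (fun y => y + -(kappaVec fun i => (x i).1)) (hsplit x).symm)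
  · rintro ⟨h1, h2⟩
    rw [hsplit x]
    exact hadd _ (hz _ h1) _ h2

open ECode in
/-- If `C` is free, then `(C^{⊥L})^{⊥L} = C` and `(C^{⊥R})^{⊥L} = C`. -/
theorem double_dual_left {n : ℕ} (C : Set (Fin n → RingE)) (hC : IsECode C)
    (hfree : IsFree C) : dualL (dualL C) = C ∧ dualL (dualR C) = C := by
  obtain ⟨B, hB⟩ := code_struct C hC hfree
  have h0B : (fun _ => (0 : ZMod 2)) ∈ B := B.zero_mem
  constructor
  · ext x
    constructor
    · intro hx
      have hx' : ∀ z : Fin n → ZMod 2, (∀ w ∈ B, ∑ i, z i * w i = 0) →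
          (∑ i, (x i).1 * z i = 0 ∧ ∑ i, (x i).2 * z i = 0) := by
        intro z hz
        have := hx (kappaVec z) (fun w hw => by
          rw [Einner_eq_zero_iff]
          refine ⟨hz _ ((hB w).1 hw).1, ?_⟩
          exact Finset.sum_eq_zero fun i _ => zero_mul _)
        exact (Einner_eq_zero_iff _ _).1 this
      exact (hB x).2 ⟨exists_separating _ B fun z hz => (hx' z hz).1,
        exists_separating _ B fun z hz => (hx' z hz).2⟩
    · intro hx z hz
      obtain ⟨h1, h2⟩ := (hB x).1 hx
      rw [Einner_eq_zero_iff]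
      have a1 := (Einner_eq_zero_iff _ _).1 (hz (kappaVec fun i => (x i).1) ((hB _).2 ⟨h1, h0B⟩))
      have a2 := (Einner_eq_zero_iff _ _).1 (hz (kappaVec fun i => (x i).2) ((hB _).2 ⟨h2, h0B⟩))
      refine ⟨?_, ?_⟩
      · rw [← a1.1]
        exact Finset.sum_congr rfl fun i _ => mul_comm _ _
      · rw [← a2.1]
        exact Finset.sum_congr rfl fun i _ => mul_comm _ _
  · ext x
    constructor
    · intro hx
      have hx' : ∀ z : Fin n → ZMod 2, (∀ w ∈ B, ∑ i, z i * w i = 0) →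
          (∑ i, (x i).1 * z i = 0 ∧ ∑ i, (x i).2 * z i = 0) := by
        intro z hz
        have := hx (kappaVec z) (fun w hw => by
          rw [Einner_eq_zero_iff]
          have b1 := hz _ ((hB w).1 hw).1
          have b2 := hz _ ((hB w).1 hw).2
          refine ⟨?_, ?_⟩
          · rw [← b1]
            exact Finset.sum_congr rfl fun i _ => mul_comm _ _
          · rw [← b2]
            exact Finset.sum_congr rfl fun i _ => mul_comm _ _)
        exact (Einner_eq_zero_iff _ _).1 this
      exact (hB x).2 ⟨exists_separating _ B fun z hz => (hx' z hz).1,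
        exists_separating _ B fun z hz => (hx' z hz).2⟩
    · intro hx z hz
      exact hz x hx
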